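/- Let G be a connected subcubic graph of order n ≥ 4 containing two adjacent vertices u and w that both have degree 2 in G and both lie on a common cycle of G. Then i(G) ≤ i(G − {u, w}) + 1, and consequently i(G) ≤ n/2 whenever i(G − {u,w}) ≤ (n−2)/2. -/

import Mathlib

open SimpleGraph

/-- `S` is an independent dominating set of `G`. -/
def IsIndepDomSet {V : Type*} (G : SimpleGraph V) (S : Set V) : Prop :=
  (∀ v ∉ S, ∃ u ∈ S, G.Adj u v) ∧ ∀ u ∈ S, ∀ v ∈ S, ¬ G.Adj u v

/-- The independent domination number `i(G)`. -/
noncomputable def indepDomNum {V : Type*} (G : SimpleGraph V) : ℕ :=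
  sInf {k | ∃ S : Set V, IsIndepDomSet G S ∧ S.ncard = k}

theorem exists_isIndepDomSet {V : Type*} [Finite V] (G : SimpleGraph V) :
    ∃ S : Set V, IsIndepDomSet G S := by
  obtain ⟨S, hS⟩ := (Set.toFinite {S : Set V | ∀ u ∈ S, ∀ v ∈ S, ¬ G.Adj u v}).exists_maximal
    ⟨∅, by simp⟩
  refine ⟨S, fun v hv => ?_, hS.prop⟩
  by_contra! h
  refine hv (hS.le_of_ge (y := insert v S) ?_ (Set.subset_insert v S) (Set.mem_insert v S))
  rintro a (rfl | ha) b (rfl | hb)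
  · exact G.irrefl
  · exact fun hab => h b hb hab.symm
  · exact h a ha
  · exact hS.prop a ha b hb

theorem exists_isIndepDomSet_ncard_eq {V : Type*} [Finite V] (G : SimpleGraph V) :
    ∃ S : Set V, IsIndepDomSet G S ∧ S.ncard = indepDomNum G := by
  obtain ⟨S, hS⟩ := exists_isIndepDomSet G
  exact Nat.sInf_mem (s := {k | ∃ S : Set V, IsIndepDomSet G S ∧ S.ncard = k})
    ⟨S.ncard, S, hS, rfl⟩

theorem IsIndepDomSet.indepDomNum_le {V : Type*} {G : SimpleGraph V} {S : Set V}
    (hS : IsIndepDomSet G S) : indepDomNum G ≤ S.ncard :=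
  Nat.sInf_le ⟨S, hS, rfl⟩

/-- Deleting two adjacent vertices lowers the independent domination number by at most one. -/
theorem indepDomNum_le_induce_compl_pair_add_one {V : Type*} [Finite V] (G : SimpleGraph V)
    {u w : V} (hadj : G.Adj u w) :
    indepDomNum G ≤ indepDomNum (G.induce ({u, w}ᶜ : Set V)) + 1 := by
  obtain ⟨T, ⟨hdom, hind⟩, hT⟩ := exists_isIndepDomSet_ncard_eq (G.induce ({u, w}ᶜ : Set V))
  set S : Set V := Subtype.val '' T with hSdef
  have hcard : S.ncard = indepDomNum (G.induce ({u, w}ᶜ : Set V)) := by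
    rw [← hT, hSdef, Set.ncard_image_of_injective _ Subtype.val_injective]
  have hSind : ∀ a ∈ S, ∀ b ∈ S, ¬ G.Adj a b := by
    rintro _ ⟨a, ha, rfl⟩ _ ⟨b, hb, rfl⟩
    exact hind a ha b hb
  have hSdom : ∀ v ∉ S, v ≠ u → v ≠ w → ∃ a ∈ S, G.Adj a v := by
    intro v hv hvu hvw
    obtain ⟨a, ha, hav⟩ := hdom ⟨v, by simp [hvu, hvw]⟩ fun h => hv ⟨_, h, rfl⟩
    exact ⟨a, ⟨a, ha, rfl⟩, hav⟩
  rw [← hcard]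
  have key : ∀ x y : V, G.Adj x y → (∀ v ∉ S, v ≠ x → v ≠ y → ∃ a ∈ S, G.Adj a v) →
      (∀ a ∈ S, ¬ G.Adj a x) → indepDomNum G ≤ S.ncard + 1 := by
    intro x y hxy hd hx
    refine le_trans (IsIndepDomSet.indepDomNum_le (S := insert x S) ⟨fun v hv => ?_, ?_⟩)
      (Set.ncard_insert_le x S)
    · rw [Set.mem_insert_iff, not_or] at hv
      by_cases hvy : v = y
      · exact ⟨x, Set.mem_insert x S, hvy ▸ hxy⟩
      · obtain ⟨a, ha, hav⟩ := hd v hv.2 hv.1 hvy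
        exact ⟨a, Set.mem_insert_of_mem x ha, hav⟩
    · rintro a (rfl | ha) b (rfl | hb)
      · exact G.irrefl
      · exact fun hab => hx b hb hab.symm
      · exact hx a ha
      · exact hSind a ha b hb
  by_cases hu : ∃ a ∈ S, G.Adj a u
  · by_cases hw : ∃ a ∈ S, G.Adj a w
    · refine (IsIndepDomSet.indepDomNum_le ⟨fun v hv => ?_, hSind⟩).trans (Nat.le_succ _)
      by_cases hvu : v = u
      · exact hvu ▸ hu
      by_cases hvw : v = w
      · exact hvw ▸ hw
      exact hSdom v hv hvu hvw
    · push Not at hw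
      exact key w u hadj.symm (fun v hv hvw hvu => hSdom v hv hvu hvw) hw
  · push Not at hu
    exact key u w hadj hSdom hu

/-- Let `G` be a connected subcubic graph of order `n ≥ 4` containing adjacent
vertices `u` and `w`, both of degree 2, lying on a common cycle of `G`.  Then
`i(G) ≤ i(G − {u, w}) + 1`, and consequently `i(G) ≤ n/2` whenever
`i(G − {u, w}) ≤ (n − 2)/2`. -/
theorem stmt_19 {V : Type*} [Fintype V] (G : SimpleGraph V)
    (hconn : G.Connected) (hsub : ∀ v : V, Nat.card (G.neighborSet v) ≤ 3)
    (hn : 4 ≤ Fintype.card V) (u w : V) (hadj : G.Adj u w)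
    (hdu : Nat.card (G.neighborSet u) = 2)
    (hdw : Nat.card (G.neighborSet w) = 2)
    (hcyc : ∃ (x : V) (c : G.Walk x x), c.IsCycle ∧
      u ∈ c.support ∧ w ∈ c.support) :
    indepDomNum G ≤ indepDomNum (G.induce ({u, w}ᶜ : Set V)) + 1 ∧
    (2 * indepDomNum (G.induce ({u, w}ᶜ : Set V)) ≤ Fintype.card V - 2 →
      2 * indepDomNum G ≤ Fintype.card V) := by
  have h := indepDomNum_le_induce_compl_pair_add_one G hadj
  exact ⟨h, by omega⟩
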